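/- Let T be a C_{p^r q^s}-transfer system, modeled on the grid Fin (r+1) × Fin (s+1), with exactly two connected components. Then T is lesser simply paired if and only if the connected component of (0,0) equals V_0 = {(0,j) : 0 ≤ j ≤ s} or equals H_0 = {(i,0) : 0 ≤ i ≤ r}. -/

import Mathlib

/-- A `C_{p^r q^s}`-transfer system, modeled on the grid `Fin (r+1) × Fin (s+1)`
with the componentwise order and componentwise minimum `⊓`. -/
def IsGridTransferSystem {r s : ℕ}
    (T : Fin (r+1) × Fin (s+1) → Fin (r+1) × Fin (s+1) → Prop) : Prop :=
  (∀ v w, T v w → v ≤ w) ∧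
  (∀ v, T v v) ∧
  (∀ u v w, T u v → T v w → T u w) ∧
  (∀ v w u, T v w → T (v ⊓ u) (w ⊓ u))

/-- Two vertices are in the same connected component of `T` if they are related by
the reflexive-transitive closure of the symmetrization of `T`. -/
def GridSameComponent {r s : ℕ}
    (T : Fin (r+1) × Fin (s+1) → Fin (r+1) × Fin (s+1) → Prop)
    (v w : Fin (r+1) × Fin (s+1)) : Prop :=
  Relation.ReflTransGen (fun x y => T x y ∨ T y x) v w

/-- `(T, T')` is a compatible pair of grid transfer systems. -/
def GridCompatible {r s : ℕ}
    (T T' : Fin (r+1) × Fin (s+1) → Fin (r+1) × Fin (s+1) → Prop) : Prop :=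
  (∀ v w, T v w → T' v w) ∧
  ∀ A B C : Fin (r+1) × Fin (s+1), B ≤ A → C ≤ A → T B A → T' (B ⊓ C) B → T' C A

/-- A grid transfer system is saturated if `u ≤ v ≤ w` and `T u w` imply `T v w`. -/
def GridSaturated {r s : ℕ}
    (T : Fin (r+1) × Fin (s+1) → Fin (r+1) × Fin (s+1) → Prop) : Prop :=
  ∀ u v w : Fin (r+1) × Fin (s+1), u ≤ v → v ≤ w → T u w → T v w

/-- `Th` is a saturated hull of `T`. -/
def GridSaturatedHull {r s : ℕ}
    (T Th : Fin (r+1) × Fin (s+1) → Fin (r+1) × Fin (s+1) → Prop) : Prop :=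
  IsGridTransferSystem Th ∧ GridSaturated Th ∧ (∀ v w, T v w → Th v w) ∧
  ∀ T'' : Fin (r+1) × Fin (s+1) → Fin (r+1) × Fin (s+1) → Prop,
    IsGridTransferSystem T'' → GridSaturated T'' →
    (∀ v w, T v w → T'' v w) → (∀ v w, Th v w → T'' v w)

/-- `T` is lesser simply paired. -/
def GridLesserSimplyPaired {r s : ℕ}
    (T : Fin (r+1) × Fin (s+1) → Fin (r+1) × Fin (s+1) → Prop) : Prop :=
  ∀ T' : Fin (r+1) × Fin (s+1) → Fin (r+1) × Fin (s+1) → Prop,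
    IsGridTransferSystem T' → (∀ v w, T v w → T' v w) →
    (GridCompatible T T' ↔ (GridSaturatedHull T T' ∨ T' = fun v w => v ≤ w))

/-- `T` has exactly two connected components: `(0,0)` and `(r,s)` are in different
components and every vertex is in the component of one of them. -/
def GridTwoComponents {r s : ℕ}
    (T : Fin (r+1) × Fin (s+1) → Fin (r+1) × Fin (s+1) → Prop) : Prop :=
  ¬ GridSameComponent T (0, 0) (Fin.last r, Fin.last s) ∧
  ∀ v, GridSameComponent T (0, 0) v ∨ GridSameComponent T (Fin.last r, Fin.last s) v

section GridLemmas

variable {r s : ℕ} {T T' : Fin (r+1) × Fin (s+1) → Fin (r+1) × Fin (s+1) → Prop}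
  {u v w m : Fin (r+1) × Fin (s+1)}

theorem grid_zero_le (v : Fin (r+1) × Fin (s+1)) : (0, 0) ≤ v :=
  ⟨Fin.zero_le _, Fin.zero_le _⟩

theorem grid_le_last (v : Fin (r+1) × Fin (s+1)) : v ≤ (Fin.last r, Fin.last s) :=
  ⟨Fin.le_last _, Fin.le_last _⟩

theorem GridSameComponent.symm (h : GridSameComponent T v w) : GridSameComponent T w v := by
  induction h with
  | refl => exact .refl
  | tail _ h ih => exact .head h.symm ih

theorem GridSameComponent.trans (h : GridSameComponent T u v) (h' : GridSameComponent T v w) :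
    GridSameComponent T u w :=
  Relation.ReflTransGen.trans h h'

theorem GridSameComponent.of_rel (h : T v w) : GridSameComponent T v w :=
  .single (.inl h)

theorem GridSameComponent.inf_right (hT : IsGridTransferSystem T) (h : GridSameComponent T v w)
    (u : Fin (r+1) × Fin (s+1)) : GridSameComponent T (v ⊓ u) (w ⊓ u) :=
  Relation.ReflTransGen.lift (· ⊓ u)
    (fun _ _ hab => hab.imp (hT.2.2.2 _ _ u) (hT.2.2.2 _ _ u)) _ _ h

/-- Every vertex `w` in the component of `v` receives a transfer from some vertex below `v`. -/
theorem GridSameComponent.exists_le_rel (hT : IsGridTransferSystem T)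
    (h : GridSameComponent T v w) : ∃ m, m ≤ v ∧ T m w := by
  induction h with
  | refl => exact ⟨v, le_rfl, hT.2.1 v⟩
  | @tail b c _ h ih =>
    obtain ⟨m, hm, hmb⟩ := ih
    rcases h with h | h
    · exact ⟨m, hm, hT.2.2.1 _ _ _ hmb h⟩
    · refine ⟨m ⊓ c, inf_le_left.trans hm, ?_⟩
      simpa [inf_eq_right.2 (hT.1 _ _ h)] using hT.2.2.2 _ _ c hmb

theorem GridSameComponent.rel_zero (hT : IsGridTransferSystem T)
    (h : GridSameComponent T (0, 0) v) : T (0, 0) v := by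
  obtain ⟨m, hm, hmv⟩ := h.exists_le_rel hT
  rwa [le_antisymm hm (grid_zero_le m)] at hmv

theorem GridSameComponent.of_saturated (hT : IsGridTransferSystem T) (hT' : GridSaturated T')
    (hTT' : ∀ v w, T v w → T' v w) (hvw : v ≤ w) (h : GridSameComponent T v w) : T' v w := by
  obtain ⟨m, hm, hmw⟩ := h.exists_le_rel hT
  exact hT' m v w hm hvw (hTT' _ _ hmw)

/-- The saturated hull of `T` is comparability within a connected component of `T`. -/
theorem gridSaturatedHull_le_and_sameComponent (hT : IsGridTransferSystem T) :
    GridSaturatedHull T fun v w => v ≤ w ∧ GridSameComponent T v w := by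
  refine ⟨⟨fun _ _ h => h.1, fun v => ⟨le_rfl, .refl⟩,
    fun _ _ _ h h' => ⟨h.1.trans h'.1, h.2.trans h'.2⟩,
    fun _ _ u h => ⟨inf_le_inf_right u h.1, h.2.inf_right hT u⟩⟩, ?_,
    fun v w h => ⟨hT.1 _ _ h, .of_rel h⟩,
    fun _ _ hs hT'' _ _ h => h.2.of_saturated hT hs hT'' h.1⟩
  intro u v w huv hvw h
  refine ⟨hvw, ?_⟩
  have := h.2.inf_right hT v
  rw [inf_eq_left.2 huv, inf_eq_right.2 hvw] at this
  exact this.symm.trans h.2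

theorem GridSaturatedHull.iff_le_and_sameComponent (hT : IsGridTransferSystem T)
    (h : GridSaturatedHull T T') : T' v w ↔ v ≤ w ∧ GridSameComponent T v w := by
  have hc := gridSaturatedHull_le_and_sameComponent hT
  exact ⟨h.2.2.2 _ hc.1 hc.2.1 hc.2.2.1 v w, hc.2.2.2 _ h.1 h.2.1 h.2.2.1 v w⟩

theorem GridSaturatedHull.compatible (hT : IsGridTransferSystem T)
    (h : GridSaturatedHull T T') : GridCompatible T T' := by
  refine ⟨h.2.2.1, fun A B C _ hCA hBA hBC => ?_⟩
  rw [h.iff_le_and_sameComponent hT] at hBC ⊢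
  have hBA := GridSameComponent.of_rel hBA
  have hCB := hBA.symm.inf_right hT C
  rw [inf_eq_right.2 hCA] at hCB
  exact ⟨hCA, (hCB.trans hBC.2).trans hBA⟩

/-- If the component of `(0, 0)` is the complement of the principal filter of an atom `m`, then
`T` is lesser simply paired. -/
theorem gridLesserSimplyPaired_of_atom (hT : IsGridTransferSystem T) (h2 : GridTwoComponents T)
    (hm : ∀ v, ¬ m ≤ v → v ⊓ m = (0, 0))
    (h0 : ∀ v, GridSameComponent T (0, 0) v ↔ ¬ m ≤ v) : GridLesserSimplyPaired T := by
  intro T' hT' hTT'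
  refine ⟨fun hc => ?_, ?_⟩
  swap
  · rintro (h | rfl)
    · exact h.compatible hT
    · exact ⟨hT.1, fun _ _ _ _ hCA _ _ => hCA⟩
  have hmA : ∀ A, m ≤ A → T m A := by
    intro A hA
    have key : ∀ v, m ≤ v → GridSameComponent T (Fin.last r, Fin.last s) v := fun v hv =>
      (h2.2 v).resolve_left fun h => (h0 v).1 h hv
    obtain ⟨n, hn, hnA⟩ := ((key m le_rfl).symm.trans (key A hA)).exists_le_rel hT
    have : m ≤ n := by
      by_contra hmn
      exact (h0 A).1 (((h0 n).2 hmn).trans (.of_rel hnA)) hA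
    rwa [le_antisymm hn this] at hnA
  have hzero : ∀ C A, C ≤ A → ¬ m ≤ A → T' C A := by
    intro C A hCA hA
    refine hc.2 A (0, 0) C (grid_zero_le _) hCA (((h0 A).2 hA).rel_zero hT) ?_
    rw [inf_eq_left.2 (grid_zero_le C)]
    exact hT'.2.1 _
  have hup : ∀ C A, C ≤ A → m ≤ C → T' C A := by
    intro C A hCA hC
    refine hc.2 A m C (hC.trans hCA) hCA (hmA A (hC.trans hCA)) ?_
    rw [inf_eq_left.2 hC]
    exact hT'.2.1 _
  by_cases hcross : ∃ v w, T' v w ∧ ¬ m ≤ v ∧ m ≤ w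
  · right
    obtain ⟨v, w, hvw, hv, hw⟩ := hcross
    have h0m : T' (0, 0) m := by
      have := hT'.2.2.2 v w m hvw
      rwa [hm v hv, inf_eq_right.2 hw] at this
    funext C A
    refine propext ⟨hT'.1 C A, fun hCA => ?_⟩
    by_cases hA : m ≤ A
    · by_cases hC : m ≤ C
      · exact hup C A hCA hC
      · refine hc.2 A m C hA hCA (hmA A hA) ?_
        rwa [inf_comm, hm C hC]
    · exact hzero C A hCA hA
  · left
    push Not at hcross
    have : T' = fun v w => v ≤ w ∧ GridSameComponent T v w := by
      funext v w
      refine propext ⟨fun h => ⟨hT'.1 _ _ h, ?_⟩, fun ⟨hvw, h⟩ => ?_⟩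
      · by_cases hv : m ≤ v
        · exact (GridSameComponent.of_rel (hmA v hv)).symm.trans
            (.of_rel (hmA w (hv.trans (hT'.1 _ _ h))))
        · exact ((h0 v).2 hv).symm.trans ((h0 w).2 (hcross v w h hv))
      · by_cases hv : m ≤ v
        · exact hup v w hvw hv
        · exact hzero v w hvw ((h0 w).1 (((h0 v).2 hv).trans h))
    rw [this]
    exact gridSaturatedHull_le_and_sameComponent hT

/-- If `T` is lesser simply paired, then a prime ideal `I` of the grid contained in the component
of `(0, 0)` is equal to it. -/
theorem GridLesserSimplyPaired.mem_of_prime_ideal (hT : IsGridTransferSystem T)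
    (h2 : GridTwoComponents T) (h : GridLesserSimplyPaired T)
    {I : Fin (r+1) × Fin (s+1) → Prop} (hI0 : I (0, 0)) (hI : ∀ v w, v ≤ w → I w → I v)
    (hIprime : ∀ v w, I (v ⊓ w) → I v ∨ I w)
    (hIsub : ∀ v, I v → GridSameComponent T (0, 0) v)
    (hv : GridSameComponent T (0, 0) v) : I v := by
  by_contra hIv
  let S : Fin (r+1) × Fin (s+1) → Fin (r+1) × Fin (s+1) → Prop :=
    fun v w => v ≤ w ∧ (GridSameComponent T v w ∨ I v)
  have hS : IsGridTransferSystem S := by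
    refine ⟨fun _ _ h => h.1, fun _ => ⟨le_rfl, .inl .refl⟩, ?_, ?_⟩
    · rintro a b c ⟨hab, h⟩ ⟨hbc, h'⟩
      refine ⟨hab.trans hbc, ?_⟩
      rcases h with h | h
      · exact h'.imp h.trans (hI a b hab)
      · exact .inr h
    · rintro a b c ⟨hab, h⟩
      exact ⟨inf_le_inf_right c hab,
        h.imp (fun h => h.inf_right hT c) (hI _ _ inf_le_left)⟩
  have hTS : ∀ v w, T v w → S v w := fun v w h => ⟨hT.1 _ _ h, .inl (.of_rel h)⟩
  have hcomp : GridCompatible T S := by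
    refine ⟨hTS, fun A B C hBA hCA hTBA hBC => ⟨hCA, ?_⟩⟩
    have hBA' := GridSameComponent.of_rel hTBA
    have hCB := hBA'.symm.inf_right hT C
    rw [inf_eq_right.2 hCA] at hCB
    rcases hBC.2 with h | h
    · exact .inl ((hCB.trans h).trans hBA')
    · refine (hIprime _ _ h).imp (fun hB => ?_) id
      have hA := (hIsub B hB).trans hBA'
      have hC := hA.inf_right hT C
      rw [inf_eq_left.2 (grid_zero_le C), inf_eq_right.2 hCA] at hC
      exact hC.symm.trans hA
  rcases (h S hS hTS).1 hcomp with hh | hh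
  · exact h2.1 ((hh.iff_le_and_sameComponent hT).1 ⟨grid_le_last _, .inr hI0⟩).2
  · have : S v (Fin.last r, Fin.last s) := by
      rw [hh]
      exact grid_le_last v
    exact this.2.elim (fun h => h2.1 (hv.trans h)) hIv

end GridLemmas

/-- A grid transfer system with exactly two connected components is lesser simply
paired iff the component of `(0,0)` is the leftmost column `V_0` or the bottom
row `H_0`. -/
theorem two_components_lsp_iff {r s : ℕ}
    (T : Fin (r+1) × Fin (s+1) → Fin (r+1) × Fin (s+1) → Prop)
    (hT : IsGridTransferSystem T) (h2 : GridTwoComponents T) :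
    GridLesserSimplyPaired T ↔
      ((∀ v, GridSameComponent T (0, 0) v ↔ v.1 = 0) ∨
       (∀ v, GridSameComponent T (0, 0) v ↔ v.2 = 0)) := by
  constructor
  · intro h
    by_cases hV : ∀ v : Fin (r+1) × Fin (s+1), v.1 = 0 → GridSameComponent T (0, 0) v
    · refine .inl fun v => ⟨?_, hV v⟩
      refine h.mem_of_prime_ideal hT h2 (I := fun v => v.1 = 0) rfl
        (fun v w hvw hw => Fin.le_zero_iff.1 (hw ▸ hvw.1)) (fun v w hvw => ?_) hV
      rcases min_choice v.1 w.1 with h | h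
      · exact .inl (h.symm.trans hvw)
      · exact .inr (h.symm.trans hvw)
    by_cases hH : ∀ v : Fin (r+1) × Fin (s+1), v.2 = 0 → GridSameComponent T (0, 0) v
    · refine .inr fun v => ⟨?_, hH v⟩
      refine h.mem_of_prime_ideal hT h2 (I := fun v => v.2 = 0) rfl
        (fun v w hvw hw => Fin.le_zero_iff.1 (hw ▸ hvw.2)) (fun v w hvw => ?_) hH
      rcases min_choice v.2 w.2 with h | h
      · exact .inl (h.symm.trans hvw)
      · exact .inr (h.symm.trans hvw)
    push Not at hV hH
    obtain ⟨⟨a, j⟩, rfl, hv⟩ := hV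
    obtain ⟨⟨i, b⟩, rfl, hw⟩ := hH
    have hv := (h2.2 _).resolve_left hv
    have hw := (h2.2 _).resolve_left hw
    have hmeet := (hv.symm.trans hw).inf_right hT (i, 0)
    have hz : ((0, j) ⊓ (i, 0) : Fin (r+1) × Fin (s+1)) = (0, 0) :=
      Prod.ext (min_eq_left (Fin.zero_le _)) (min_eq_right (Fin.zero_le _))
    rw [hz, inf_idem] at hmeet
    exact (h2.1 (hmeet.trans hw.symm)).elim
  · rintro (h | h)
    · have hr : r ≠ 0 := by
        rintro rfl
        exact h2.1 ((h _).2 rfl)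
      obtain ⟨r, rfl⟩ := Nat.exists_eq_succ_of_ne_zero hr
      have hle : ∀ v : Fin (r+1+1) × Fin (s+1), ¬ ((1, 0) : Fin (r+1+1) × Fin (s+1)) ≤ v ↔
          v.1 = 0 := fun v => by
        simp [Prod.le_def, Fin.lt_one_iff]
      refine gridLesserSimplyPaired_of_atom (m := (1, 0)) hT h2 (fun v hv => ?_)
        fun v => (h v).trans (hle v).symm
      exact Prod.ext ((congrArg (· ⊓ 1) ((hle v).1 hv)).trans (min_eq_left (Fin.zero_le _)))
        (min_eq_right (Fin.zero_le _))
    · have hs : s ≠ 0 := by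
        rintro rfl
        exact h2.1 ((h _).2 rfl)
      obtain ⟨s, rfl⟩ := Nat.exists_eq_succ_of_ne_zero hs
      have hle : ∀ v : Fin (r+1) × Fin (s+1+1), ¬ ((0, 1) : Fin (r+1) × Fin (s+1+1)) ≤ v ↔
          v.2 = 0 := fun v => by
        simp [Prod.le_def, Fin.lt_one_iff]
      refine gridLesserSimplyPaired_of_atom (m := (0, 1)) hT h2 (fun v hv => ?_)
        fun v => (h v).trans (hle v).symm
      exact Prod.ext (min_eq_right (Fin.zero_le _))
        ((congrArg (· ⊓ 1) ((hle v).1 hv)).trans (min_eq_left (Fin.zero_le _)))
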